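/- Let I be a (2,∞)-instance (every firm has at most two acceptable workers) or an (∞,2)-instance (every worker has at most two acceptable firms), let σ be an offering order on I, and let e=(p,q) ∈ E satisfy qopt(I)(q)=p. Then p ≻_q sfda(I∖e,σ∖e)(q), i.e., after deleting e, the SFDA output leaves q unmatched or matched to a firm she prefers strictly less than p. -/

import Mathlib

namespace SeqMatching

/-- A matching instance `I = (P, Q, E, ≻)`: firms `P`, workers `Q`, a finite set `E`
of acceptable pairs, and strict preferences encoded by rank functions
(lower rank = more preferred), injective on acceptable partners.
For a firm `p`, `q ≻_p q'` means `rankP p q < rankP p q'`; symmetrically for workers. -/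
structure MI (P Q : Type) where
  E : Finset (P × Q)
  rankP : P → Q → ℕ
  rankQ : Q → P → ℕ
  injP : ∀ p q q', (p, q) ∈ E → (p, q') ∈ E → rankP p q = rankP p q' → q = q'
  injQ : ∀ q p p', (p, q) ∈ E → (p', q) ∈ E → rankQ q p = rankQ q p' → p = p'

namespace MI

variable {P Q : Type}

/-- `μ` is a matching in `I`: a subset of `E` in which every firm and every worker
occurs in at most one pair. -/
def IsMatching (I : MI P Q) (μ : Finset (P × Q)) : Prop :=
  μ ⊆ I.E ∧ ∀ e ∈ μ, ∀ f ∈ μ, (e.1 = f.1 ∨ e.2 = f.2) → e = f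

/-- `μ(q) ⪰_q p`: worker `q` is matched in `μ` to `p` or to a firm she strictly prefers to `p`. -/
def WAtLeast (I : MI P Q) (μ : Finset (P × Q)) (q : Q) (p : P) : Prop :=
  ∃ p', (p', q) ∈ μ ∧ (p' = p ∨ I.rankQ q p' < I.rankQ q p)

/-- `p ≻_q μ(q)`: worker `q` is unmatched in `μ` or matched to a firm strictly less preferred than `p`. -/
def WBelow (I : MI P Q) (μ : Finset (P × Q)) (q : Q) (p : P) : Prop :=
  ∀ p', (p', q) ∈ μ → I.rankQ q p < I.rankQ q p'

/-- `q ≻_p μ(p)`: firm `p` is unmatched in `μ` or matched to a worker strictly less preferred than `q`. -/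
def FBelow (I : MI P Q) (μ : Finset (P × Q)) (p : P) (q : Q) : Prop :=
  ∀ q', (p, q') ∈ μ → I.rankP p q < I.rankP p q'

/-- the acceptable pair `e = (p, q)` blocks `μ`. -/
def Blocks (I : MI P Q) (μ : Finset (P × Q)) (e : P × Q) : Prop :=
  e ∈ I.E ∧ I.FBelow μ e.1 e.2 ∧ I.WBelow μ e.2 e.1

/-- `μ` is a stable matching in `I`. -/
def IsStable (I : MI P Q) (μ : Finset (P × Q)) : Prop :=
  I.IsMatching μ ∧ ∀ e, ¬ I.Blocks μ e

/-- `μ(q) ⪰_q μ'(q)`: worker `q` weakly prefers `μ` to `μ'`. -/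
def WGe (I : MI P Q) (μ μ' : Finset (P × Q)) (q : Q) : Prop :=
  ∀ p', (p', q) ∈ μ' → I.WAtLeast μ q p'

/-- `μ` is the Q-optimal (worker-optimal) stable matching of `I`. -/
def IsQOpt (I : MI P Q) (μ : Finset (P × Q)) : Prop :=
  I.IsStable μ ∧ ∀ μ', I.IsStable μ' → ∀ q, I.WGe μ μ' q

open scoped Classical in
/-- the Q-optimal stable matching `qopt(I)` (it exists and is unique by Gale–Shapley). -/
noncomputable def qopt (I : MI P Q) : Finset (P × Q) :=
  if h : ∃ μ, I.IsQOpt μ then h.choose else ∅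

/-- `q` is the most preferred worker on `p`'s list. -/
def TopForFirm (I : MI P Q) (p : P) (q : Q) : Prop :=
  (p, q) ∈ I.E ∧ ∀ q', (p, q') ∈ I.E → I.rankP p q ≤ I.rankP p q'

/-- `p` is the most preferred firm on `q`'s list. -/
def TopForWorker (I : MI P Q) (q : Q) (p : P) : Prop :=
  (p, q) ∈ I.E ∧ ∀ p', (p', q) ∈ I.E → I.rankQ q p ≤ I.rankQ q p'

variable [DecidableEq P] [DecidableEq Q]

/-- a (2,∞)-instance: every firm has at most two acceptable workers. -/
def FirmsDegTwo (I : MI P Q) : Prop :=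
  ∀ p : P, (I.E.filter (fun f => f.1 = p)).card ≤ 2

/-- an (∞,2)-instance: every worker has at most two acceptable firms. -/
def WorkersDegTwo (I : MI P Q) : Prop :=
  ∀ q : Q, (I.E.filter (fun f => f.2 = q)).card ≤ 2

/-- the deletion `I ∖ e`. -/
def del (I : MI P Q) (e : P × Q) : MI P Q where
  E := I.E.erase e
  rankP := I.rankP
  rankQ := I.rankQ
  injP := fun p q q' h h' hr =>
    I.injP p q q' (Finset.mem_of_mem_erase h) (Finset.mem_of_mem_erase h') hr
  injQ := fun q p p' h h' hr =>
    I.injQ q p p' (Finset.mem_of_mem_erase h) (Finset.mem_of_mem_erase h') hr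

/-- the contraction `I / e`: all pairs containing the firm or the worker of `e` are removed. -/
def contr (I : MI P Q) (e : P × Q) : MI P Q where
  E := I.E.filter (fun f => f.1 ≠ e.1 ∧ f.2 ≠ e.2)
  rankP := I.rankP
  rankQ := I.rankQ
  injP := fun p q q' h h' hr =>
    I.injP p q q' (Finset.filter_subset _ _ h) (Finset.filter_subset _ _ h') hr
  injQ := fun q p p' h h' hr =>
    I.injQ q p p' (Finset.filter_subset _ _ h) (Finset.filter_subset _ _ h') hr

/-- `σ` is an offering order on `I`: an enumeration of `E` without repetition, consistent
with the firms' preferences (if `e ≻_p f` for two offers of the same firm, `e` comes first). -/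
def IsOfferOrder (I : MI P Q) (σ : List (P × Q)) : Prop :=
  σ.Nodup ∧ (∀ e, e ∈ σ ↔ e ∈ I.E) ∧
    ∀ e f, e ∈ σ → f ∈ σ → e.1 = f.1 → I.rankP e.1 e.2 < I.rankP f.1 f.2 →
      σ.idxOf e < σ.idxOf f

/-- restriction `σ / e` of the order `σ` to the pairs of `I / e`. -/
def contrO (σ : List (P × Q)) (e : P × Q) : List (P × Q) :=
  σ.filter (fun f => decide (f.1 ≠ e.1 ∧ f.2 ≠ e.2))

theorem qopt_subset (I : MI P Q) : I.qopt ⊆ I.E := by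
  unfold qopt
  split
  · next h => exact h.choose_spec.1.1.1
  · exact Finset.empty_subset _

/-- the sequentially fixing deferred acceptance algorithm: repeatedly fix the pair of
`qopt` of the current instance that comes first in the offering order. -/
noncomputable def sfda (I : MI P Q) (σ : List (P × Q)) : Finset (P × Q) :=
  match h : σ.find? (fun f => decide (f ∈ I.qopt)) with
  | none => ∅
  | some e => insert e ((I.contr e).sfda (contrO σ e))
termination_by σ.length
decreasing_by
  have he : e ∈ σ := List.mem_of_find?_eq_some h
  have hfail : ¬ (fun f => decide (f.1 ≠ e.1 ∧ f.2 ≠ e.2)) e = true := by simp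
  exact List.length_filter_lt_length_iff_exists.mpr ⟨e, he, hfail⟩

open scoped Classical in
/-- the SPE matching `spe(I, σ)` of the sequential matching game `(I, σ)`. -/
noncomputable def spe (I : MI P Q) (σ : List (P × Q)) : Finset (P × Q) :=
  match σ with
  | [] => ∅
  | e :: rest =>
    if I.WBelow ((I.del e).spe rest) e.2 e.1
    then insert e ((I.contr e).spe (contrO rest e))
    else (I.del e).spe rest
termination_by σ.length
decreasing_by
  all_goals simp only [contrO, List.length_cons]
  all_goals first
    | omega
    | exact Nat.lt_succ_of_le (List.length_filter_le _ _)


theorem qopt_spec (I : MI P Q) : I.qopt = ∅ ∨ I.IsQOpt I.qopt := by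
  unfold qopt
  split
  · next h => exact Or.inr h.choose_spec
  · exact Or.inl rfl

theorem contr_stable (I : MI P Q) (μ : Finset (P × Q)) (h : I.IsStable μ) (e : P × Q)
    (he : e ∈ μ) : (I.contr e).IsStable (μ.erase e) := by
  obtain ⟨⟨hsub, hm⟩, hb⟩ := h
  refine ⟨⟨?_, ?_⟩, ?_⟩
  · intro f hf
    obtain ⟨hne, hf⟩ := Finset.mem_erase.1 hf
    refine Finset.mem_filter.2 ⟨hsub hf, ?_, ?_⟩
    · intro h1; exact hne (hm f hf e he (Or.inl h1))
    · intro h1; exact hne (hm f hf e he (Or.inr h1))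
  · intro a ha b hb' hab
    exact hm a (Finset.mem_of_mem_erase ha) b (Finset.mem_of_mem_erase hb') hab
  · rintro f ⟨hfE, hF, hW⟩
    obtain ⟨hfE, h1, h2⟩ := Finset.mem_filter.1 hfE
    refine hb f ⟨hfE, ?_, ?_⟩
    · intro q' hq'
      refine hF q' (Finset.mem_erase.2 ⟨?_, hq'⟩)
      rintro rfl; exact h1 rfl
    · intro p' hp'
      refine hW p' (Finset.mem_erase.2 ⟨?_, hp'⟩)
      rintro rfl; exact h2 rfl

theorem card_fst (I : MI P Q) (μ : Finset (P × Q)) (h : I.IsMatching μ) :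
    (μ.image Prod.fst).card = μ.card :=
  Finset.card_image_of_injOn (fun a ha b hb hab => h.2 a ha b hb (Or.inl hab))

theorem card_snd (I : MI P Q) (μ : Finset (P × Q)) (h : I.IsMatching μ) :
    (μ.image Prod.snd).card = μ.card :=
  Finset.card_image_of_injOn (fun a ha b hb hab => h.2 a ha b hb (Or.inr hab))

/-- rural hospitals theorem for comparable stable matchings. -/
theorem rural (I : MI P Q) (μ ν : Finset (P × Q)) (hμ : I.IsStable μ) (hν : I.IsStable ν)
    (hge : ∀ q, I.WGe ν μ q) :
    ν.image Prod.fst = μ.image Prod.fst ∧ μ.image Prod.snd = ν.image Prod.snd := by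
  have h1 : ν.image Prod.fst ⊆ μ.image Prod.fst := by
    intro p hp
    obtain ⟨⟨p, w⟩, hpw, rfl⟩ := Finset.mem_image.1 hp
    by_contra hno
    have hno' : ∀ w', (p, w') ∉ μ := fun w' hw' => hno (Finset.mem_image.2 ⟨_, hw', rfl⟩)
    refine hμ.2 (p, w) ⟨hν.1.1 hpw, fun w' hw' => absurd hw' (hno' w'), ?_⟩
    intro p' hp'
    obtain ⟨p'', hp'', hh⟩ := hge w p' hp'
    have heq : p'' = p := congrArg Prod.fst (hν.1.2 _ hp'' _ hpw (Or.inr rfl))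
    subst heq
    rcases hh with rfl | hh
    · exact absurd hp' (hno' w)
    · exact hh
  have h2 : μ.image Prod.snd ⊆ ν.image Prod.snd := by
    intro w hw
    obtain ⟨⟨p, w⟩, hpw, rfl⟩ := Finset.mem_image.1 hw
    obtain ⟨p'', hp'', -⟩ := hge w p hpw
    exact Finset.mem_image.2 ⟨_, hp'', rfl⟩
  have c1 := Finset.card_le_card h1
  have c2 := Finset.card_le_card h2
  have a := I.card_fst μ hμ.1
  have b := I.card_snd μ hμ.1
  have c := I.card_fst ν hν.1
  have d := I.card_snd ν hν.1
  exact ⟨Finset.eq_of_subset_of_card_le h1 (by omega),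
    Finset.eq_of_subset_of_card_le h2 (by omega)⟩

theorem sfda_subset (I : MI P Q) (σ : List (P × Q)) : I.sfda σ ⊆ I.E := by
  induction hn : σ.length using Nat.strong_induction_on generalizing I σ with
  | _ n ih =>
    rw [sfda]
    split
    · exact Finset.empty_subset _
    · next e h =>
      have he : e ∈ σ := List.mem_of_find?_eq_some h
      have heq : e ∈ I.qopt := by simpa using List.find?_some h
      have hlt : (contrO σ e).length < n := by
        rw [← hn]
        exact List.length_filter_lt_length_iff_exists.mpr ⟨e, he, by simp⟩
      intro f hf
      rcases Finset.mem_insert.1 hf with rfl | hf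
      · exact I.qopt_subset heq
      · exact Finset.filter_subset _ _ (ih _ hlt (I.contr e) _ rfl hf)

theorem sfda_workers (I : MI P Q) (σ : List (P × Q)) :
    (I.sfda σ).image Prod.snd ⊆ I.qopt.image Prod.snd := by
  induction hn : σ.length using Nat.strong_induction_on generalizing I σ with
  | _ n ih =>
    rw [sfda]
    split
    · simp
    · next e h =>
      have he : e ∈ σ := List.mem_of_find?_eq_some h
      have heq : e ∈ I.qopt := by simpa using List.find?_some h
      have hlt : (contrO σ e).length < n := by
        rw [← hn]
        exact List.length_filter_lt_length_iff_exists.mpr ⟨e, he, by simp⟩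
      have ih' := ih _ hlt (I.contr e) _ rfl
      rw [Finset.image_insert]
      refine Finset.insert_subset (Finset.mem_image_of_mem _ heq) (ih'.trans ?_)
      rcases (I.contr e).qopt_spec with h0 | hν
      · rw [h0]; simp
      · rcases I.qopt_spec with h0 | hμ
        · rw [h0] at heq; simp at heq
        have hs := I.contr_stable _ hμ.1 e heq
        rw [← ((I.contr e).rural _ _ hs hν.1 (hν.2 _ hs)).2]
        exact Finset.image_subset_image (Finset.erase_subset _ _)

theorem deg_firm (I : MI P Q) (h : I.FirmsDegTwo) (p : P) (a b c : Q) (ha : (p, a) ∈ I.E)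
    (hb : (p, b) ∈ I.E) (hc : (p, c) ∈ I.E) (hab : a ≠ b) (hac : a ≠ c) : b = c := by
  by_contra hbc
  have := h p
  have hs : ({(p, a), (p, b), (p, c)} : Finset (P × Q)) ⊆ I.E.filter (fun f => f.1 = p) := by
    intro f hf
    simp only [Finset.mem_insert, Finset.mem_singleton] at hf
    rcases hf with rfl | rfl | rfl <;> simp [*]
  have hc := Finset.card_le_card hs
  rw [Finset.card_eq_three.2 ⟨(p, a), (p, b), (p, c), by simp [hab], by simp [hac],
    by simp [hbc], rfl⟩] at hc
  omega

theorem deg_worker (I : MI P Q) (h : I.WorkersDegTwo) (q : Q) (a b c : P) (ha : (a, q) ∈ I.E)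
    (hb : (b, q) ∈ I.E) (hc : (c, q) ∈ I.E) (hab : a ≠ b) (hac : a ≠ c) : b = c := by
  by_contra hbc
  have := h q
  have hs : ({(a, q), (b, q), (c, q)} : Finset (P × Q)) ⊆ I.E.filter (fun f => f.2 = q) := by
    intro f hf
    simp only [Finset.mem_insert, Finset.mem_singleton] at hf
    rcases hf with rfl | rfl | rfl <;> simp [*]
  have hc := Finset.card_le_card hs
  rw [Finset.card_eq_three.2 ⟨(a, q), (b, q), (c, q), by simp [hab], by simp [hac],
    by simp [hbc], rfl⟩] at hc
  omega

theorem FirmsDegTwo.mono (I J : MI P Q) (h : I.FirmsDegTwo) (hs : J.E ⊆ I.E) :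
    J.FirmsDegTwo :=
  fun p => (Finset.card_le_card (Finset.filter_subset_filter _ hs)).trans (h p)

/-- in a (2,∞)-instance, contraction of a pair of the optimal matching keeps the rest. -/
theorem contr_qopt (I : MI P Q) (hd : I.FirmsDegTwo) (μ ν : Finset (P × Q)) (hμ : I.IsQOpt μ)
    (e : P × Q) (he : e ∈ μ) (hν : (I.contr e).IsQOpt ν) : ν ⊆ μ := by
  have hs := I.contr_stable _ hμ.1 e he
  have hge := hν.2 _ hs
  have hr := (I.contr e).rural _ _ hs hν.1 hge
  have hνE : ∀ f ∈ ν, f ∈ I.E ∧ f.1 ≠ e.1 ∧ f.2 ≠ e.2 := fun f hf =>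
    Finset.mem_filter.1 (hν.1.1.1 hf)
  have hst : I.IsStable (insert e ν) := by
    refine ⟨⟨?_, ?_⟩, ?_⟩
    · exact Finset.insert_subset (hμ.1.1.1 he) (fun f hf => (hνE f hf).1)
    · intro a ha₀ b hb₀ hab
      rcases Finset.mem_insert.1 ha₀ with rfl | ha <;> rcases Finset.mem_insert.1 hb₀ with rfl | hb
      · rfl
      · have := hνE b hb
        rcases hab with h | h
        · exact absurd h.symm this.2.1
        · exact absurd h.symm this.2.2
      · have := hνE a ha
        rcases hab with h | h
        · exact absurd h this.2.1
        · exact absurd h this.2.2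
      · exact hν.1.1.2 a ha b hb hab
    · rintro ⟨x, w⟩ ⟨hE, hF, hW⟩
      obtain ⟨p', q'⟩ := e
      simp only at hF hW
      have hF' : ∀ w', (x, w') ∈ ν → I.rankP x w < I.rankP x w' :=
        fun w' h => hF w' (Finset.mem_insert_of_mem h)
      have hW' : ∀ x', (x', w) ∈ ν → I.rankQ w x < I.rankQ w x' :=
        fun x' h => hW x' (Finset.mem_insert_of_mem h)
      by_cases hx : x = p'
      · subst hx
        have h1 := hF q' (Finset.mem_insert_self _ _)
        refine hμ.1.2 (x, w) ⟨hE, ?_, ?_⟩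
        · intro w' hw'
          have : w' = q' := congrArg Prod.snd (hμ.1.1.2 _ hw' _ he (Or.inl rfl))
          subst this; exact h1
        · intro x' hx'
          have hne : (x', w) ≠ (x, q') := by
            intro h
            have : w = q' := congrArg Prod.snd h
            subst this; exact lt_irrefl _ h1
          obtain ⟨x'', hx'', hh⟩ := hge w x' (Finset.mem_erase.2 ⟨hne, hx'⟩)
          have h2 := hW' x'' hx''
          rcases hh with rfl | hh
          · exact h2
          · exact h2.trans hh
      · by_cases hw : w = q'
        · subst hw
          have h1 := hW p' (Finset.mem_insert_self _ _)
          refine hμ.1.2 (x, w) ⟨hE, ?_, ?_⟩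
          · intro w1 hw1
            have hne : (x, w1) ≠ (p', w) := fun h => hx (congrArg Prod.fst h)
            have hw1w : w ≠ w1 := by
              rintro rfl
              exact hne (hμ.1.1.2 _ hw1 _ he (Or.inr rfl))
            have hxm : x ∈ ν.image Prod.fst := by
              rw [hr.1]
              exact Finset.mem_image.2 ⟨_, Finset.mem_erase.2 ⟨hne, hw1⟩, rfl⟩
            obtain ⟨⟨x2, w2⟩, h2, h3⟩ := Finset.mem_image.1 hxm
            simp only at h3
            subst h3
            have h4 := hνE _ h2
            have : w1 = w2 := I.deg_firm hd x2 w w1 w2 hE (hμ.1.1.1 hw1) h4.1 hw1w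
              (Ne.symm h4.2.2)
            subst this
            exact hF' _ h2
          · intro x' hx'
            have : x' = p' := congrArg Prod.fst (hμ.1.1.2 _ hx' _ he (Or.inr rfl))
            subst this; exact h1
        · exact hν.1.2 (x, w) ⟨Finset.mem_filter.2 ⟨hE, hx, hw⟩, hF', hW'⟩
  rintro ⟨x, w⟩ hf
  obtain ⟨x', hx', hh⟩ := hμ.2 _ hst w x (Finset.mem_insert_of_mem hf)
  rcases hh with rfl | hh
  · exact hx'
  have hne : (x', w) ≠ e := by
    rintro rfl
    exact (hνE _ hf).2.2 rfl
  obtain ⟨x'', hx'', hh'⟩ := hge w x' (Finset.mem_erase.2 ⟨hne, hx'⟩)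
  have heq : x'' = x := congrArg Prod.fst (hν.1.1.2 _ hx'' _ hf (Or.inr rfl))
  subst heq
  rcases hh' with rfl | hh'
  · exact hx'
  · exact absurd (lt_trans hh hh') (lt_irrefl _)

theorem sfda_firms (I : MI P Q) (hd : I.FirmsDegTwo) (σ : List (P × Q)) :
    I.sfda σ ⊆ I.qopt := by
  induction hn : σ.length using Nat.strong_induction_on generalizing I σ with
  | _ n ih =>
    rw [sfda]
    split
    · simp
    · next e h =>
      have he : e ∈ σ := List.mem_of_find?_eq_some h
      have heq : e ∈ I.qopt := by simpa using List.find?_some h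
      have hlt : (contrO σ e).length < n := by
        rw [← hn]
        exact List.length_filter_lt_length_iff_exists.mpr ⟨e, he, by simp⟩
      have ih' := ih _ hlt (I.contr e)
        (FirmsDegTwo.mono I _ hd (Finset.filter_subset _ _)) _ rfl
      refine Finset.insert_subset heq (ih'.trans ?_)
      rcases (I.contr e).qopt_spec with h0 | hν
      · rw [h0]; simp
      · rcases I.qopt_spec with h0 | hμ
        · rw [h0] at heq; simp at heq
        exact I.contr_qopt hd _ _ hμ e heq hν

/-- the claim for `qopt` in place of `sfda`. -/
theorem qopt_del (I : MI P Q) (p : P) (q : Q)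
    (μ₀ : Finset (P × Q)) (h₀ : I.IsQOpt μ₀) (hpq : (p, q) ∈ μ₀) :
    I.WBelow (I.del (p, q)).qopt q p := by
  rcases (I.del (p, q)).qopt_spec with h0 | hμ
  · rw [h0]; intro p' hp'; simp at hp'
  intro p' hp'
  by_contra hlt
  obtain ⟨hne, hE⟩ := Finset.mem_erase.1 (hμ.1.1.1 hp')
  have hpp : p' ≠ p := by rintro rfl; exact hne rfl
  have hst : I.IsStable (I.del (p, q)).qopt := by
    refine ⟨⟨fun f hf => Finset.mem_of_mem_erase (hμ.1.1.1 hf), hμ.1.1.2⟩, ?_⟩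
    rintro f ⟨hfE, hF, hW⟩
    by_cases hf : f = (p, q)
    · subst hf; exact hlt (hW p' hp')
    · exact hμ.1.2 f ⟨Finset.mem_erase.2 ⟨hf, hfE⟩, hF, hW⟩
  obtain ⟨p'', hp'', hh⟩ := h₀.2 _ hst q p' hp'
  have heq : p'' = p := congrArg Prod.fst (h₀.1.1.2 _ hp'' _ hpq (Or.inr rfl))
  subst heq
  rcases hh with rfl | hh
  · exact hpp rfl
  · exact hlt hh

/-- in a (2,∞)- or (∞,2)-instance, if `qopt(I)(q) = p` for `e = (p, q) ∈ E`,
then `p ≻_q sfda(I ∖ e, σ ∖ e)(q)`. -/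
theorem stmt_9 (P Q : Type) [DecidableEq P] [DecidableEq Q] (I : MI P Q)
    (hdeg : I.FirmsDegTwo ∨ I.WorkersDegTwo)
    (σ : List (P × Q)) (hσ : I.IsOfferOrder σ) (p : P) (q : Q)
    (he : (p, q) ∈ I.E)
    (μ₀ : Finset (P × Q)) (h₀ : I.IsQOpt μ₀) (hpq : (p, q) ∈ μ₀) :
    I.WBelow ((I.del (p, q)).sfda (σ.erase (p, q))) q p := by
  have hq := I.qopt_del p q μ₀ h₀ hpq
  have hJ : (I.del (p, q)).E ⊆ I.E := Finset.erase_subset _ _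
  intro p' hp'
  rcases hdeg with hd | hd
  · exact hq p' ((I.del (p, q)).sfda_firms (FirmsDegTwo.mono I _ hd hJ) _ hp')
  · have hw := (I.del (p, q)).sfda_workers _ (Finset.mem_image.2 ⟨_, hp', rfl⟩)
    obtain ⟨⟨p'', q''⟩, h2, h3⟩ := Finset.mem_image.1 hw
    simp only at h3
    subst h3
    have m1 := (I.del (p, q'')).sfda_subset _ hp'
    have m2 := (I.del (p, q'')).qopt_subset h2
    obtain ⟨n1, m1⟩ := Finset.mem_erase.1 m1
    obtain ⟨n2, m2⟩ := Finset.mem_erase.1 m2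
    have : p'' = p' := I.deg_worker hd q'' p p'' p' he m2 m1
      (by rintro rfl; exact n2 rfl) (by rintro rfl; exact n1 rfl)
    subst this
    exact hq _ h2

end MI

end SeqMatching
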